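/- arXiv:2312.07889 — 2 statements merged into one kernel-verified Lean document; each statement's English description precedes it below -/
import Mathlib

section
/- SIMP compliance sensitivity formula: the compliance C is differentiable at ρ* and for every design-variable index j, ∂C/∂ρ_j (ρ*) = − Σₑ p (E₀ − E_min) (ρₑ(ρ*))^{p−1} Nₑⱼ (Uᵀ K₀ₑ U), where U = K(ρ*)⁻¹ F. -/
open scoped Matrix

attribute [local instance] Matrix.normedAddCommGroup Matrix.normedSpace

theorem simp_aux_general {V R ι : Type*} [NormedAddCommGroup V] [NormedSpace ℝ V]
    [NormedRing R] [NormedAlgebra ℝ R] [FiniteDimensional ℝ R] [Fintype ι]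
    (A : ι → R) (c : ι → V → ℝ) (c' : ι → V →L[ℝ] ℝ) (x : V)
    (hc : ∀ e, HasFDerivAt (c e) (c' e) x)
    (K : V → R) (hK : ∀ y, K y = ∑ e, c e y • A e)
    (L' : R → ℝ) (hadd : ∀ a b, L' (a + b) = L' a + L' b)
    (hsmul : ∀ (t : ℝ) a, L' (t • a) = t * L' a) (C : V → ℝ) (hC : ∀ y, IsUnit (K y) → C y = L' (Ring.inverse (K y)))
    (hx : IsUnit (K x)) :
    DifferentiableAt ℝ C x ∧ ∀ v, fderiv ℝ C x v =
      -∑ e, c' e v * L' (Ring.inverse (K x) * A e * Ring.inverse (K x)) := by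
  haveI : CompleteSpace R := FiniteDimensional.complete ℝ R
  let L0 : R →ₗ[ℝ] ℝ := { toFun := L', map_add' := hadd, map_smul' := hsmul }
  let L : R →L[ℝ] ℝ := LinearMap.toContinuousLinearMap L0
  have hL : ∀ a, L a = L' a := fun a => rfl
  simp only [← hL] at hC ⊢
  have hKd : HasFDerivAt K (∑ e, (c' e).smulRight (A e)) x := by
    have h : HasFDerivAt (fun y => ∑ e, c e y • A e) (∑ e, (c' e).smulRight (A e)) x :=
      HasFDerivAt.fun_sum fun e _ => (hc e).smul_const (A e)
    rwa [← funext hK] at h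
  obtain ⟨u, hu⟩ := hx
  have hev : ∀ᶠ y in nhds x, IsUnit (K y) :=
    hKd.continuousAt.eventually (Units.isOpen.mem_nhds ⟨u, hu⟩)
  have h1 := hasFDerivAt_ringInverse (𝕜 := ℝ) u
  rw [hu] at h1
  have h2 := (L.hasFDerivAt.comp x (h1.comp x hKd))
  have h3 := h2.congr_of_eventuallyEq (f₁ := C) (hev.mono fun y hy => hC y hy)
  refine ⟨h3.differentiableAt, fun v => ?_⟩
  rw [h3.fderiv, ← hu, Ring.inverse_unit]
  simp [Finset.mul_sum, Finset.sum_mul]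

/-- SIMP compliance sensitivity formula: the compliance `C` is differentiable at `ρ*`
and for every design-variable index `j`,
`∂C/∂ρ_j (ρ*) = − Σₑ p (E₀ − E_min) (ρₑ(ρ*))^(p−1) Nₑⱼ (Uᵀ K₀ₑ U)` with `U = K(ρ*)⁻¹ F`. -/
theorem simp_compliance_sensitivity {m nE n : ℕ}
    (F : Fin m → ℝ)
    (K0 : Fin nE → Matrix (Fin m) (Fin m) ℝ)
    (hK0symm : ∀ e, (K0 e).IsSymm)
    (N : Fin nE → Fin n → ℝ)
    (E0 Emin : ℝ) (p : ℕ) (hp : 1 ≤ p)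
    (ρelt : Fin nE → (Fin n → ℝ) → ℝ)
    (hρelt : ∀ e ρ, ρelt e ρ = ∑ j, N e j * ρ j)
    (E : ℝ → ℝ) (hE : ∀ x, E x = Emin + x ^ p * (E0 - Emin))
    (K : (Fin n → ℝ) → Matrix (Fin m) (Fin m) ℝ)
    (hK : ∀ ρ, K ρ = ∑ e, E (ρelt e ρ) • K0 e)
    (C : (Fin n → ℝ) → ℝ)
    (hC : ∀ ρ, IsUnit (K ρ).det → C ρ = F ⬝ᵥ ((K ρ)⁻¹ *ᵥ F))
    (ρstar : Fin n → ℝ)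
    (hinv : IsUnit (K ρstar).det) :
    DifferentiableAt ℝ C ρstar ∧
    ∀ j : Fin n,
      fderiv ℝ C ρstar (Pi.single j 1) =
        -∑ e, (p : ℝ) * (E0 - Emin) * (ρelt e ρstar) ^ (p - 1) * N e j *
          (((K ρstar)⁻¹ *ᵥ F) ⬝ᵥ (K0 e *ᵥ ((K ρstar)⁻¹ *ᵥ F))) := by
  letI : NormedRing (Matrix (Fin m) (Fin m) ℝ) := Matrix.linftyOpNormedRing
  letI : NormedAlgebra ℝ (Matrix (Fin m) (Fin m) ℝ) := Matrix.linftyOpNormedAlgebra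
  let r : Fin nE → (Fin n → ℝ) →L[ℝ] ℝ := fun e =>
    ∑ j, N e j • ContinuousLinearMap.proj (R := ℝ) (φ := fun _ : Fin n => ℝ) j
  have hr : ∀ e ρ, r e ρ = ρelt e ρ := by
    intro e ρ
    simp [r, hρelt]
  have hc : ∀ e, HasFDerivAt (fun ρ => E (ρelt e ρ))
      (((p : ℝ) * (ρelt e ρstar) ^ (p - 1) * (E0 - Emin)) • r e) ρstar := by
    intro e
    have h1 : HasDerivAt E ((p : ℝ) * (ρelt e ρstar) ^ (p - 1) * (E0 - Emin)) (r e ρstar) := by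
      rw [hr, funext hE]
      exact ((hasDerivAt_pow p _).mul_const _).const_add _
    have h2 := h1.comp_hasFDerivAt ρstar (r e).hasFDerivAt
    have h3 : (E ∘ fun ρ => r e ρ) = fun ρ => E (ρelt e ρ) := by
      funext ρ
      simp [hr]
    rw [← h3]
    exact h2
  have hsymm : (K ρstar)⁻¹ᵀ = (K ρstar)⁻¹ := by
    rw [Matrix.transpose_nonsing_inv, hK, Matrix.transpose_sum]
    simp_rw [Matrix.transpose_smul, fun e => (hK0symm e).eq]
  have key := simp_aux_general K0 (fun e ρ => E (ρelt e ρ)) _ ρstar hc K hK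
    (fun M => F ⬝ᵥ (M *ᵥ F))
    (fun M M' => by rw [Matrix.add_mulVec, dotProduct_add])
    (fun a M => by rw [← smul_eq_mul, ← dotProduct_smul, ← Matrix.smul_mulVec]) C
    (fun y hy => by
      rw [hC y ((Matrix.isUnit_iff_isUnit_det _).1 hy), Matrix.nonsing_inv_eq_ringInverse])
    ((Matrix.isUnit_iff_isUnit_det _).2 hinv)
  refine ⟨key.1, fun j => ?_⟩
  rw [key.2]
  congr 1
  refine Finset.sum_congr rfl fun e _ => ?_
  rw [← Matrix.nonsing_inv_eq_ringInverse]
  have h4 : F ⬝ᵥ (((K ρstar)⁻¹ * K0 e * (K ρstar)⁻¹) *ᵥ F) =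
      ((K ρstar)⁻¹ *ᵥ F) ⬝ᵥ (K0 e *ᵥ ((K ρstar)⁻¹ *ᵥ F)) := by
    rw [← Matrix.mulVec_mulVec, ← Matrix.mulVec_mulVec, Matrix.dotProduct_mulVec,
      ← Matrix.mulVec_transpose, hsymm]
  have h5 : r e (Pi.single j 1) = N e j := by
    rw [hr, hρelt]
    simp [Pi.single_apply]
  rw [h4, ContinuousLinearMap.smul_apply, h5, smul_eq_mul]
  ring
end

section
/- Nonpositivity of SIMP compliance sensitivities: if in addition E₀ ≥ E_min, each K₀ₑ is positive semidefinite, ρₑ(ρ*) ≥ 0 for every element e, and Nₑⱼ ≥ 0 for every element e, then for every design-variable index j the partial derivative satisfies ∂C/∂ρ_j (ρ*) ≤ 0; that is, increasing any density design variable does not increase the compliance to first order. -/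
open scoped Matrix

attribute [local instance] Matrix.normedAddCommGroup Matrix.normedSpace

/-- Nonpositivity of SIMP compliance sensitivities: if `E₀ ≥ E_min`, each `K₀ₑ` is
positive semidefinite, `ρₑ(ρ*) ≥ 0` for every element `e`, and `Nₑⱼ ≥ 0`, then for
every design-variable index `j` one has `∂C/∂ρ_j (ρ*) ≤ 0`. -/
theorem simp_compliance_sensitivity_nonpos {m nE n : ℕ}
    (F : Fin m → ℝ)
    (K0 : Fin nE → Matrix (Fin m) (Fin m) ℝ)
    (hK0symm : ∀ e, (K0 e).IsSymm)
    (N : Fin nE → Fin n → ℝ)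
    (E0 Emin : ℝ) (p : ℕ) (hp : 1 ≤ p)
    (ρelt : Fin nE → (Fin n → ℝ) → ℝ)
    (hρelt : ∀ e ρ, ρelt e ρ = ∑ j, N e j * ρ j)
    (E : ℝ → ℝ) (hE : ∀ x, E x = Emin + x ^ p * (E0 - Emin))
    (K : (Fin n → ℝ) → Matrix (Fin m) (Fin m) ℝ)
    (hK : ∀ ρ, K ρ = ∑ e, E (ρelt e ρ) • K0 e)
    (C : (Fin n → ℝ) → ℝ)
    (hC : ∀ ρ, IsUnit (K ρ).det → C ρ = F ⬝ᵥ ((K ρ)⁻¹ *ᵥ F))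
    (ρstar : Fin n → ℝ)
    (hinv : IsUnit (K ρstar).det)
    (hE0 : Emin ≤ E0)
    (hpsd : ∀ e, (K0 e).PosSemidef)
    (hρnonneg : ∀ e, 0 ≤ ρelt e ρstar)
    (hN : ∀ e j, 0 ≤ N e j) :
    ∀ j : Fin n, fderiv ℝ C ρstar (Pi.single j 1) ≤ 0 := by
  intro j
  by_cases hd : DifferentiableAt ℝ C ρstar
  swap
  · simp [fderiv_zero_of_not_differentiableAt hd]
  set v : Fin n → ℝ := Pi.single j 1 with hv
  have hlin : ∀ e (t : ℝ), ρelt e (ρstar + t • v) = ρelt e ρstar + t * N e j := by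
    intro e t
    rw [hρelt, hρelt]
    simp only [Pi.add_apply, Pi.smul_apply, smul_eq_mul, mul_add, Finset.sum_add_distrib, hv]
    congr 1
    rw [Finset.sum_eq_single j]
    · simp [mul_comm]
    · intro b _ hb
      simp [hb]
    · simp
  let a : Fin nE → ℝ → ℝ := fun e t => E (ρelt e (ρstar + t • v))
  have ha : ∀ e t, a e t = Emin + (ρelt e ρstar + t * N e j) ^ p * (E0 - Emin) := by
    intro e t
    simp only [a, hlin, hE]
  have haderiv : ∀ e, HasDerivAt (a e)
      ((p * (ρelt e ρstar) ^ (p - 1) * N e j) * (E0 - Emin)) 0 := by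
    intro e
    have h1 : HasDerivAt (fun t : ℝ => ρelt e ρstar + t * N e j) (N e j) 0 := by
      simpa using ((hasDerivAt_id (0 : ℝ)).mul_const (N e j)).const_add (ρelt e ρstar)
    have h2 := ((h1.pow p).mul_const (E0 - Emin)).const_add Emin
    have h3 : a e = fun t => Emin + (ρelt e ρstar + t * N e j) ^ p * (E0 - Emin) :=
      funext (ha e)
    rw [h3]
    simpa using h2
  let A : ℝ → Matrix (Fin m) (Fin m) ℝ := fun t => K (ρstar + t • v)
  have hA : ∀ t, A t = ∑ e, a e t • K0 e := fun t => hK _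
  have hA0 : A 0 = K ρstar := by simp [A]
  have hac : ∀ e, Continuous (a e) := by
    intro e
    rw [show a e = _ from funext (ha e)]
    fun_prop
  have hAc : Continuous A := by
    rw [show A = _ from funext hA]
    exact continuous_finsetSum _ (fun e _ => (hac e).smul continuous_const)
  have hdetc : Continuous fun t => (A t).det := hAc.matrix_det
  have hdet0 : (A 0).det ≠ 0 := by rw [hA0]; exact hinv.ne_zero
  have hev : ∀ᶠ t in nhds (0 : ℝ), (A t).det ≠ 0 := hdetc.continuousAt.eventually_ne hdet0
  let u : ℝ → Fin m → ℝ := fun t => (A t)⁻¹ *ᵥ F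
  have huc : ContinuousAt u 0 := by
    have h1 : u = fun t => ((A t).det)⁻¹ • ((A t).adjugate *ᵥ F) := by
      funext t
      simp only [u, Matrix.inv_def, Ring.inverse_eq_inv', Matrix.smul_mulVec]
    rw [h1]
    exact (hdetc.continuousAt.inv₀ hdet0).smul
      (hAc.matrix_adjugate.matrix_mulVec continuous_const).continuousAt
  have hAu : ∀ t, (A t).det ≠ 0 → A t *ᵥ u t = F := by
    intro t ht
    simp only [u, Matrix.mulVec_mulVec]
    rw [Matrix.mul_nonsing_inv _ (isUnit_iff_ne_zero.mpr ht), Matrix.one_mulVec]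
  have hsymm : ∀ t, (A t)ᵀ = A t := by
    intro t
    rw [hA, Matrix.transpose_sum]
    exact Finset.sum_congr rfl fun e _ => by rw [Matrix.transpose_smul, (hK0symm e).eq]
  let g : Fin nE → ℝ → ℝ := fun e t => u 0 ⬝ᵥ (K0 e *ᵥ u t)
  have hgc : ∀ e, ContinuousAt (g e) 0 := by
    intro e
    have : Continuous fun w : Fin m → ℝ => u 0 ⬝ᵥ (K0 e *ᵥ w) :=
      continuous_const.dotProduct (continuous_const.matrix_mulVec continuous_id)
    exact this.continuousAt.comp huc
  have hg0 : ∀ e, 0 ≤ g e 0 := by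
    intro e
    simpa using (hpsd e).dotProduct_mulVec_nonneg (u 0)
  have hAdot : ∀ s t, u 0 ⬝ᵥ (A s *ᵥ u t) = ∑ e, a e s * g e t := by
    intro s t
    rw [hA, Matrix.sum_mulVec, dotProduct_sum]
    exact Finset.sum_congr rfl fun e _ => by
      rw [Matrix.smul_mulVec, dotProduct_smul, smul_eq_mul]
  have hCt : ∀ t, (A t).det ≠ 0 → C (ρstar + t • v) = F ⬝ᵥ u t :=
    fun t ht => hC _ (isUnit_iff_ne_zero.mpr ht)
  have hdiff : ∀ t, (A t).det ≠ 0 →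
      C (ρstar + t • v) - C (ρstar + (0 : ℝ) • v) = - ∑ e, (a e t - a e 0) * g e t := by
    intro t ht
    rw [hCt t ht, hCt 0 hdet0]
    have e1 : F ⬝ᵥ u t = ∑ e, a e 0 * g e t := by
      rw [← hAdot, Matrix.dotProduct_mulVec (u 0), ← Matrix.mulVec_transpose, hsymm, hAu 0 hdet0]
    have e2 : F ⬝ᵥ u 0 = ∑ e, a e t * g e t := by
      rw [← hAdot, hAu t ht, dotProduct_comm]
    rw [e1, e2, ← Finset.sum_sub_distrib, ← Finset.sum_neg_distrib]
    exact Finset.sum_congr rfl fun e _ => by ring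
  have hline : HasDerivAt (fun t : ℝ => C (ρstar + t • v)) (fderiv ℝ C ρstar v) 0 :=
    hd.hasFDerivAt.hasLineDerivAt v
  have hT1 := hasDerivAt_iff_tendsto_slope.mp hline
  have hT2 : Filter.Tendsto (fun t => - ∑ e, slope (a e) 0 t * g e t)
      (nhdsWithin 0 {0}ᶜ)
      (nhds (- ∑ e, ((p * (ρelt e ρstar) ^ (p - 1) * N e j) * (E0 - Emin)) * g e 0)) := by
    refine (tendsto_finsetSum _ fun e _ => ?_).neg
    exact (hasDerivAt_iff_tendsto_slope.mp (haderiv e)).mul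
      ((hgc e).tendsto.mono_left nhdsWithin_le_nhds)
  have hT3 : (fun t => - ∑ e, slope (a e) 0 t * g e t) =ᶠ[nhdsWithin 0 {0}ᶜ]
      slope (fun t : ℝ => C (ρstar + t • v)) 0 := by
    filter_upwards [nhdsWithin_le_nhds hev] with t ht
    simp only [slope_def_module, smul_eq_mul]
    rw [hdiff t ht, mul_neg, Finset.mul_sum]
    congr 1
    exact Finset.sum_congr rfl fun e _ => by ring
  rw [tendsto_nhds_unique hT1 (hT2.congr' hT3)]
  refine neg_nonpos.mpr (Finset.sum_nonneg fun e _ => ?_)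
  have := hρnonneg e
  have := hN e j
  exact mul_nonneg (mul_nonneg (by positivity) (sub_nonneg.mpr hE0)) (hg0 e)
end
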